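/- arXiv:2001.08628 — 2 statements merged into one kernel-verified Lean document; each statement's English description precedes it below -/
import Mathlib

section
/- Let P be a finite nonempty poset with ground set X and, for each x ∈ X, let Q_x be a finite nonempty poset. Then ldim(Σ_{x∈P} Q_x) ≤ ldim(P) + max_{x∈X} ldim(Q_x). -/
open scoped Classical

namespace PaperLD

/-- A partial linear extension of a poset `α`: a duplicate-free list whose
listing order extends the partial order on the elements it contains. -/
structure PLE (α : Type*) [PartialOrder α] where
  toList : List α
  nodup : toList.Nodup
  le_imp : ∀ i j : Fin toList.length, toList.get i ≤ toList.get j → i ≤ j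

/-- `x` occurs (weakly) before `y` in the partial linear extension `L`
(in particular both `x` and `y` belong to the ground set of `L`). -/
def PLE.Before {α : Type*} [PartialOrder α] (L : PLE α) (x y : α) : Prop :=
  ∃ i j : Fin L.toList.length, i ≤ j ∧ L.toList.get i = x ∧ L.toList.get j = y

/-- A family of partial linear extensions is a local realiser if, for every
ordered pair `(x, y)` with `x ≱ y`, some member lists `x` before `y`. -/
def IsLocalRealiser {α : Type*} [PartialOrder α] {ι : Type*} (F : ι → PLE α) : Prop :=
  ∀ x y : α, ¬ y ≤ x → ∃ i, (F i).Before x y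

/-- The multiplicity of `x` in a finite family of partial linear extensions:
the number of members whose ground set contains `x`. -/
noncomputable def mult {α : Type*} [PartialOrder α] {N : ℕ} (F : Fin N → PLE α) (x : α) : ℕ :=
  (Finset.univ.filter fun i => x ∈ (F i).toList).card

/-- The local dimension of a finite poset: the least `d` such that there is a
local realiser in which every element has multiplicity at most `d`. -/
noncomputable def ldim (α : Type*) [PartialOrder α] [Fintype α] : ℕ :=
  sInf {d | ∃ (N : ℕ) (F : Fin N → PLE α), IsLocalRealiser F ∧ ∀ x : α, mult F x ≤ d}

/-- The order dimension of a finite poset: the least `d` such that some family of `d`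
linear extensions (partial linear extensions containing every element) is a realiser. -/
noncomputable def odim (α : Type*) [PartialOrder α] [Fintype α] : ℕ :=
  sInf {d | ∃ F : Fin d → PLE α, (∀ i, ∀ x : α, x ∈ (F i).toList) ∧ IsLocalRealiser F}

/-- `BoolLayers n ℓ k` is the suborder of the Boolean lattice `Q(n)` induced by the
`ℓ`-th and `k`-th layers: all subsets of an `n`-set of cardinality `ℓ` or `k`,
ordered by inclusion. -/
abbrev BoolLayers (n ℓ k : ℕ) := {s : Finset (Fin n) // s.card = ℓ ∨ s.card = k}

end PaperLD

namespace PaperLD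

section PLE

variable {α β : Type*} [PartialOrder α] [PartialOrder β]

/-- A list no element of which is preceded by one above or equal to it is a partial
linear extension. -/
def PLE.ofPairwise (l : List α) (h : l.Pairwise fun a b => ¬ b ≤ a) : PLE α where
  toList := l
  nodup := h.imp fun hab e => hab e.ge
  le_imp i j hij := not_lt.1 fun hji => List.pairwise_iff_get.1 h j i hji hij

theorem PLE.pairwise (L : PLE α) : L.toList.Pairwise fun a b => ¬ b ≤ a :=
  List.pairwise_iff_get.2 fun i j hij h => (L.le_imp j i h).not_gt hij

theorem PLE.before_of_sublist (L : PLE α) {x y : α} (h : [x, y].Sublist L.toList) :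
    L.Before x y :=
  List.pairwise_iff_forall_sublist.1
    (List.pairwise_iff_get.2 fun i j hij => ⟨i, j, hij.le, rfl, rfl⟩) h

theorem PLE.Before.sublist {L : PLE α} {x y : α} (h : L.Before x y) (hne : x ≠ y) :
    [x, y].Sublist L.toList := by
  obtain ⟨i, j, hij, rfl, rfl⟩ := h
  have hp : L.toList.Pairwise fun a b => [a, b].Sublist L.toList :=
    List.pairwise_iff_forall_sublist.2 id
  exact List.pairwise_iff_get.1 hp i j (lt_of_le_of_ne hij fun e => hne (by rw [e]))

/-- The image of a partial linear extension under an order embedding. -/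
def PLE.map (L : PLE α) (f : α ↪o β) : PLE β :=
  .ofPairwise (L.toList.map f) <| List.pairwise_map.2 <| L.pairwise.imp fun h h' =>
    h (f.le_iff_le.1 h')

/-- Every finite poset has a linear extension. -/
theorem exists_linear_ple (α : Type*) [PartialOrder α] [Fintype α] :
    ∃ L : PLE α, ∀ x, x ∈ L.toList := by
  let _ : Fintype (LinearExtension α) := inferInstanceAs (Fintype α)
  let l : List (LinearExtension α) := (Finset.univ : Finset (LinearExtension α)).sort (· ≤ ·)
  have hl : l.Pairwise (· < ·) := (Finset.sortedLT_sort _).pairwise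
  have hlt (a b : α) (hab : toLinearExtension a < toLinearExtension b) : ¬ b ≤ a :=
    fun h => hab.not_ge (toLinearExtension.monotone h)
  have hα : List.Pairwise (fun a b : α => ¬ b ≤ a) l :=
    hl.imp (hlt _ _)
  refine ⟨.ofPairwise l hα, fun x => ?_⟩
  · exact (Finset.mem_sort (α := LinearExtension α) (· ≤ ·)).2 (Finset.mem_univ _)

/-- Local realisers may be indexed by an arbitrary finite type. -/
theorem ldim_le_of_isLocalRealiser [Fintype α] {ι : Type*} [Fintype ι] {F : ι → PLE α}
    (hF : IsLocalRealiser F) {d : ℕ}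
    (hd : ∀ x, (Finset.univ.filter fun i => x ∈ (F i).toList).card ≤ d) : ldim α ≤ d := by
  let e := Fintype.equivFin ι
  refine Nat.sInf_le ⟨Fintype.card ι, F ∘ e.symm, fun x y h => ?_, fun x => ?_⟩
  · obtain ⟨i, hi⟩ := hF x y h
    exact ⟨e i, by simpa using hi⟩
  · refine le_trans (Finset.card_le_card_of_injOn e.symm ?_ e.symm.injective.injOn) (hd x)
    intro i hi
    simpa using hi

/-- The local dimension is attained by some finite local realiser. -/
theorem exists_isLocalRealiser_mult_le_ldim (α : Type*) [PartialOrder α] [Fintype α] :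
    ∃ (N : ℕ) (F : Fin N → PLE α), IsLocalRealiser F ∧ ∀ x, mult F x ≤ ldim α := by
  let e := Fintype.equivFin {p : α × α // ¬ p.2 ≤ p.1}
  let G (p : {p : α × α // ¬ p.2 ≤ p.1}) : PLE α :=
    .ofPairwise [p.1.1, p.1.2] (by simpa using p.2)
  refine Nat.sInf_mem (s := {d | ∃ (N : ℕ) (F : Fin N → PLE α),
    IsLocalRealiser F ∧ ∀ x : α, mult F x ≤ d}) ⟨_, _, G ∘ e.symm, fun x y h => ?_,
    fun x => Finset.card_le_univ _⟩
  refine ⟨e ⟨(x, y), h⟩, PLE.before_of_sublist _ ?_⟩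
  simp [G, PLE.ofPairwise]

end PLE

section Lex

variable {α : Type*} [PartialOrder α] {Q : α → Type*} [∀ x, PartialOrder (Q x)]

/-- The inclusion of a summand into a lexicographic sum. -/
def lexFiber (x : α) : Q x ↪o Σₗ x, Q x where
  toFun y := toLex ⟨x, y⟩
  inj' := toLex.injective.comp sigma_mk_injective
  map_rel_iff' := by
    intro a b
    constructor
    · rintro (⟨_, _, h⟩ | ⟨_, _, h⟩)
      · exact absurd h (lt_irrefl _)
      · exact h
    · exact fun h => Sigma.Lex.right _ _ h

theorem lexFiber_le_iff_of_ne {x z : α} (h : x ≠ z) (y : Q x) (w : Q z) :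
    lexFiber x y ≤ lexFiber z w ↔ x ≤ z := by
  constructor
  · rintro (⟨_, _, h'⟩ | ⟨_, _, h'⟩)
    · exact h'.le
    · exact le_rfl
  · exact fun h' => Sigma.Lex.left _ _ (lt_of_le_of_ne h' h)

theorem lexFiber_eq_fst {x z : α} {y : Q x} {w : Q z} (h : lexFiber x y = lexFiber z w) :
    x = z :=
  congrArg Sigma.fst (toLex.injective h)

/-- Replace each element of a partial linear extension of the index poset by a partial
linear extension of the corresponding summand. -/
def PLE.lexSum (L : PLE α) (M : ∀ x, PLE (Q x)) : PLE (Σₗ x, Q x) :=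
  .ofPairwise (L.toList.flatMap fun x => (M x).toList.map (lexFiber x)) <| by
    refine List.pairwise_flatMap.2 ⟨fun x _ => ((M x).map (lexFiber x)).pairwise,
      L.pairwise.imp ?_⟩
    intro x z hxz a ha b hb
    obtain ⟨y, -, rfl⟩ := List.mem_map.1 ha
    obtain ⟨w, -, rfl⟩ := List.mem_map.1 hb
    rwa [lexFiber_le_iff_of_ne fun e => hxz e.le]

theorem PLE.lexFiber_mem_lexSum {L : PLE α} {M : ∀ x, PLE (Q x)} {x : α} {y : Q x}
    (h : lexFiber x y ∈ (L.lexSum M).toList) : x ∈ L.toList := by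
  obtain ⟨z, hz, h⟩ := List.mem_flatMap.1 h
  obtain ⟨w, -, h⟩ := List.mem_map.1 h
  exact lexFiber_eq_fst h ▸ hz

theorem PLE.Before.lexSum {L : PLE α} {M : ∀ x, PLE (Q x)} {x z : α} (h : L.Before x z)
    (hne : x ≠ z) {y : Q x} {w : Q z} (hy : y ∈ (M x).toList) (hw : w ∈ (M z).toList) :
    (L.lexSum M).Before (lexFiber x y) (lexFiber z w) := by
  refine PLE.before_of_sublist _ (List.Sublist.trans ?_ ((h.sublist hne).flatMap _))
  simpa using (List.singleton_sublist.2 (List.mem_map_of_mem hy)).append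
    (List.singleton_sublist.2 (List.mem_map_of_mem hw))

theorem PLE.Before.map {β : Type*} [PartialOrder β] {L : PLE α} {x y : α} (h : L.Before x y)
    (hne : x ≠ y) (f : α ↪o β) : (L.map f).Before (f x) (f y) :=
  PLE.before_of_sublist _ ((h.sublist hne).map f)

/-- The local realiser of a lexicographic sum built from a local realiser `F` of the index
poset, a linear extension `M x` of each summand, and a local realiser `G x` of each summand. -/
def lexFamily {ι : Type*} {κ : α → Type*} (F : ι → PLE α) (M : ∀ x, PLE (Q x))
    (G : ∀ x, κ x → PLE (Q x)) : ι ⊕ (Σ x, κ x) → PLE (Σₗ x, Q x) :=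
  Sum.elim (fun i => (F i).lexSum M) fun p => (G p.1 p.2).map (lexFiber p.1)

theorem isLocalRealiser_lexFamily {ι : Type*} {κ : α → Type*} {F : ι → PLE α}
    {M : ∀ x, PLE (Q x)} {G : ∀ x, κ x → PLE (Q x)} (hF : IsLocalRealiser F)
    (hM : ∀ x y, y ∈ (M x).toList) (hG : ∀ x, IsLocalRealiser (G x)) :
    IsLocalRealiser (lexFamily F M G) := by
  rintro ⟨x, y⟩ ⟨z, w⟩ h
  change ¬ lexFiber z w ≤ lexFiber x y at h
  by_cases hxz : x = z
  · subst hxz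
    have hyw : ¬ w ≤ y := fun hwy => h ((lexFiber x).map_rel_iff.2 hwy)
    obtain ⟨i, hi⟩ := hG x y w hyw
    exact ⟨.inr ⟨x, i⟩, hi.map (fun e => hyw e.ge) _⟩
  · rw [lexFiber_le_iff_of_ne (Ne.symm hxz)] at h
    obtain ⟨i, hi⟩ := hF x z h
    exact ⟨.inl i, hi.lexSum hxz (hM x y) (hM z w)⟩

theorem card_filter_mem_lexFamily_le [Fintype α] {ι : Type*} [Fintype ι] {κ : α → Type*}
    [∀ x, Fintype (κ x)] (F : ι → PLE α) (M : ∀ x, PLE (Q x)) (G : ∀ x, κ x → PLE (Q x))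
    (x : α) (y : Q x) :
    (Finset.univ.filter fun i => lexFiber x y ∈ (lexFamily F M G i).toList).card ≤
      (Finset.univ.filter fun i => x ∈ (F i).toList).card +
        (Finset.univ.filter fun i => y ∈ (G x i).toList).card := by
  let f : ι ⊕ κ x → ι ⊕ (Σ x, κ x) := Sum.map id (Sigma.mk x)
  rw [← Finset.card_disjSum]
  refine le_trans (Finset.card_le_card (t := Finset.image f _) ?_) Finset.card_image_le
  rintro (i | ⟨z, i⟩) hi
  · have h := PLE.lexFiber_mem_lexSum (Finset.mem_filter.1 hi).2
    exact Finset.mem_image.2 ⟨.inl i, by simpa using h, rfl⟩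
  · obtain ⟨w, hw, h⟩ := List.mem_map.1 (Finset.mem_filter.1 hi).2
    obtain rfl := lexFiber_eq_fst h
    obtain rfl := (lexFiber z).injective h
    exact Finset.mem_image.2 ⟨.inr i, by simpa using hw, rfl⟩

end Lex

end PaperLD

open PaperLD

/-- The local dimension of a lexicographic sum is at most the local dimension of the
indexing poset plus the maximum of the local dimensions of the summands. -/
theorem stmt3 (α : Type) [PartialOrder α] [Fintype α] [Nonempty α]
    (Q : α → Type) [∀ x, PartialOrder (Q x)] [∀ x, Fintype (Q x)] [∀ x, Nonempty (Q x)] :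
    ldim (Σₗ x, Q x) ≤ ldim α + (Finset.univ.sup fun x => ldim (Q x)) := by
  obtain ⟨N, F, hF, hFd⟩ := exists_isLocalRealiser_mult_le_ldim α
  choose n G hG hGd using fun x => exists_isLocalRealiser_mult_le_ldim (Q x)
  choose M hM using fun x => exists_linear_ple (Q x)
  refine ldim_le_of_isLocalRealiser (isLocalRealiser_lexFamily hF hM hG) ?_
  rintro ⟨x, y⟩
  have h := (card_filter_mem_lexFamily_le F M G x y).trans (add_le_add (hFd x) (hGd x y))
  refine le_trans (by convert h using 3; rfl) (Nat.add_le_add_left ?_ _)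
  exact Finset.le_sup (f := fun x => ldim (Q x)) (Finset.mem_univ x)
end

section
/- There is a constant C > 0 such that for every integer n ≥ 4, ldim(Q(n)) ≥ ldim(Q(n; 1, ⌊n/2⌋)) ≥ n / log n − C · n · log log n / (log n)². -/
open scoped Classical

namespace PaperLD

section Before

variable {α : Type*} [PartialOrder α]

theorem PLE.Before.mem_left {L : PLE α} {x y : α} (h : L.Before x y) : x ∈ L.toList := by
  obtain ⟨i, _, _, rfl, _⟩ := h
  exact List.get_mem _ _

theorem PLE.Before.mem_right {L : PLE α} {x y : α} (h : L.Before x y) : y ∈ L.toList := by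
  obtain ⟨_, j, _, _, rfl⟩ := h
  exact List.get_mem _ _

theorem PLE.Before.trans {L : PLE α} {x y z : α} (h₁ : L.Before x y) (h₂ : L.Before y z) :
    L.Before x z := by
  obtain ⟨i, j, hij, rfl, hj⟩ := h₁
  obtain ⟨j', k, hjk, hj', rfl⟩ := h₂
  have : j = j' := L.nodup.injective_get (hj.trans hj'.symm)
  exact ⟨i, k, hij.trans (this ▸ hjk), rfl, rfl⟩

theorem PLE.Before.antisymm {L : PLE α} {x y : α} (h₁ : L.Before x y) (h₂ : L.Before y x) :
    x = y := by
  obtain ⟨i, j, hij, hi, hj⟩ := h₁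
  obtain ⟨j', i', hji, hj', hi'⟩ := h₂
  have h₁ : j = j' := L.nodup.injective_get (hj.trans hj'.symm)
  have h₂ : i = i' := L.nodup.injective_get (hi.trans hi'.symm)
  subst h₁ h₂
  rw [← hi, ← hj, le_antisymm hij hji]

theorem PLE.before_total (L : PLE α) {x y : α} (hx : x ∈ L.toList) (hy : y ∈ L.toList) :
    L.Before x y ∨ L.Before y x := by
  obtain ⟨i, rfl⟩ := List.mem_iff_get.1 hx
  obtain ⟨j, rfl⟩ := List.mem_iff_get.1 hy
  exact (le_total i j).imp (fun h => ⟨i, j, h, rfl, rfl⟩) (fun h => ⟨j, i, h, rfl, rfl⟩)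

theorem PLE.before_of_le (L : PLE α) {x y : α} (hx : x ∈ L.toList) (hy : y ∈ L.toList)
    (h : x ≤ y) : L.Before x y := by
  obtain ⟨i, rfl⟩ := List.mem_iff_get.1 hx
  obtain ⟨j, rfl⟩ := List.mem_iff_get.1 hy
  exact ⟨i, j, L.le_imp i j h, rfl, rfl⟩

theorem PLE.before_iff_sublist (L : PLE α) {x y : α} (hxy : x ≠ y) :
    L.Before x y ↔ [x, y].Sublist L.toList := by
  constructor
  · rintro ⟨i, j, hij, rfl, rfl⟩
    have hlt : i < j := lt_of_le_of_ne hij fun h => hxy (h ▸ rfl)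
    have := List.map_getElem_sublist (l := L.toList) (is := [i, j]) (by simpa using hlt)
    simpa using this
  · intro h
    obtain ⟨is, his, hp⟩ := List.sublist_eq_map_getElem h
    match is, his, hp with
    | [i, j], his, hp =>
      simp only [List.map_cons, List.map_nil, List.cons.injEq, and_true] at his
      have hlt : i < j := by simpa using hp
      exact ⟨i, j, hlt.le, his.1.symm, his.2.symm⟩

/-- The restriction of a partial linear extension to a subposet. -/
noncomputable def PLE.restrict (p : α → Prop) (L : PLE α) : PLE {x // p x} where
  toList := (L.toList.filter fun x => decide (p x)).attachWith p (by simp)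
  nodup := by
    apply List.Nodup.of_map Subtype.val
    rw [List.attachWith_map_subtype_val]
    exact L.nodup.filter _
  le_imp := by
    have key : ((L.toList.filter fun x => decide (p x)).attachWith p (by simp)).Pairwise
        fun a b => ¬ b ≤ a := by
      have h : L.toList.Pairwise fun a b => ¬ b ≤ a :=
        List.pairwise_iff_get.2 fun i j hij h => (L.le_imp j i h).not_gt hij
      have h' := h.filter fun x => decide (p x)
      rw [← List.attachWith_map_subtype_val (l := L.toList.filter fun x => decide (p x))
        (p := p) (by simp), List.pairwise_map] at h'
      exact h'
    intro i j hij
    by_contra! hlt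
    exact List.pairwise_iff_get.1 key j i hlt hij

theorem PLE.restrict_map (p : α → Prop) (L : PLE α) :
    (L.restrict p).toList.map Subtype.val = L.toList.filter fun x => decide (p x) :=
  List.attachWith_map_subtype_val _

theorem PLE.mem_restrict (p : α → Prop) (L : PLE α) (x : {x // p x}) :
    x ∈ (L.restrict p).toList ↔ x.1 ∈ L.toList := by
  rw [← List.mem_map_of_injective Subtype.val_injective, PLE.restrict_map]
  simp [x.2]

theorem PLE.Before.restrict (p : α → Prop) {L : PLE α} {x y : {x // p x}} (hxy : x ≠ y)
    (h : L.Before x.1 y.1) : (L.restrict p).Before x y := by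
  rw [PLE.before_iff_sublist _ hxy]
  have h' := ((L.before_iff_sublist fun h => hxy (Subtype.ext h)).1 h).filter
    fun x => decide (p x)
  rw [← PLE.restrict_map, List.sublist_map_iff] at h'
  obtain ⟨l, hl, he⟩ := h'
  have he' : [x, y].map Subtype.val = l.map Subtype.val := by
    rw [← he]
    simp [x.2, y.2]
  rwa [List.map_injective_iff.2 Subtype.val_injective he']

end Before

section Realiser

variable {α : Type*} [PartialOrder α]

/-- The two-element partial linear extension listing `x` before `y`. -/
def PLE.pair (x y : α) (h : ¬ y ≤ x) : PLE α where
  toList := [x, y]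
  nodup := by simpa using fun e : x = y => h e.ge
  le_imp := by
    intro i j hij
    by_contra! hlt
    have hp : [x, y].Pairwise fun a b => ¬ b ≤ a := by simpa using h
    exact List.pairwise_iff_get.1 hp j i hlt hij

theorem exists_isLocalRealiser (α : Type*) [PartialOrder α] [Fintype α] :
    ∃ (N : ℕ) (F : Fin N → PLE α), IsLocalRealiser F := by
  let e := Fintype.equivFin {p : α × α // ¬ p.2 ≤ p.1}
  refine ⟨_, fun i => PLE.pair _ _ (e.symm i).2, fun x y h => ⟨e ⟨(x, y), h⟩, ?_⟩⟩
  beta_reduce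
  rw [e.symm_apply_apply]
  exact ⟨⟨0, by simp [PLE.pair]⟩, ⟨1, by simp [PLE.pair]⟩, by simp, rfl, rfl⟩

theorem mult_le {N : ℕ} (F : Fin N → PLE α) (x : α) : mult F x ≤ N :=
  (Finset.card_filter_le _ _).trans (by simp)

theorem exists_mult_le_ldim (α : Type*) [PartialOrder α] [Fintype α] :
    ∃ (N : ℕ) (F : Fin N → PLE α), IsLocalRealiser F ∧ ∀ x : α, mult F x ≤ ldim α := by
  refine Nat.sInf_mem
    (s := {d | ∃ (N : ℕ) (F : Fin N → PLE α), IsLocalRealiser F ∧ ∀ x : α, mult F x ≤ d}) ?_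
  obtain ⟨N, F, hF⟩ := exists_isLocalRealiser α
  exact ⟨N, N, F, hF, mult_le F⟩

theorem ldim_subtype_le [Fintype α] (p : α → Prop) [Fintype {x // p x}] :
    ldim {x // p x} ≤ ldim α := by
  obtain ⟨N, F, hF, hm⟩ := exists_mult_le_ldim α
  refine Nat.sInf_le ⟨N, fun i => (F i).restrict p, fun x y h => ?_, fun x => ?_⟩
  · obtain ⟨i, hi⟩ := hF x.1 y.1 h
    exact ⟨i, hi.restrict p fun e => h e.ge⟩
  · refine le_trans (le_of_eq ?_) (hm x.1)
    simp only [mult, PLE.mem_restrict]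

end Realiser

section Cuts

variable {α β : Type*} [PartialOrder α] [Fintype β] {N : ℕ}

/-- The pairs `(i, b)` such that `s b` is the first element of `s` listed after `a` in `F i`. -/
noncomputable def cuts (F : Fin N → PLE α) (s : β → α) (a : α) : Finset (Fin N × β) :=
  Finset.univ.filter fun q =>
    (F q.1).Before a (s q.2) ∧ ∀ b, (F q.1).Before a (s b) → (F q.1).Before (s q.2) (s b)

theorem card_cuts_le (F : Fin N → PLE α) {s : β → α} (hs : Function.Injective s) (a : α) :
    (cuts F s a).card ≤ mult F a := by
  refine Finset.card_le_card_of_injOn Prod.fst ?_ ?_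
  · rintro ⟨i, b⟩ h
    simp only [cuts, Finset.coe_filter, Set.mem_ofPred_eq] at h
    simpa using h.2.1.mem_left
  · rintro ⟨i, b⟩ h ⟨j, c⟩ h' (rfl : i = j)
    simp only [cuts, Finset.coe_filter, Set.mem_ofPred_eq] at h h'
    have := hs ((h.2.2 c h'.2.1).antisymm (h'.2.2 b h.2.1))
    rw [this]

theorem exists_mem_cuts (F : Fin N → PLE α) (s : β → α) {a : α} {b : β} {i : Fin N}
    (h : (F i).Before a (s b)) : ∃ c, (i, c) ∈ cuts F s a ∧ (F i).Before (s c) (s b) := by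
  obtain ⟨c, hc, hmin⟩ := Finset.exists_min_image
    (Finset.univ.filter fun c => (F i).Before a (s c)) (fun c => (F i).toList.idxOf (s c))
    ⟨b, by simpa using h⟩
  simp only [Finset.mem_filter, Finset.mem_univ, true_and] at hc hmin
  have key : ∀ b, (F i).Before a (s b) → (F i).Before (s c) (s b) := fun b hb =>
    ⟨⟨_, List.idxOf_lt_length_iff.2 hc.mem_right⟩, ⟨_, List.idxOf_lt_length_iff.2 hb.mem_right⟩,
      hmin b hb, by simp, by simp⟩
  exact ⟨c, by simpa [cuts] using ⟨hc, key⟩, key b h⟩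

/-- All possible cuts: the occurrences of elements of `s` in the members of `F`. -/
noncomputable def occurrences (F : Fin N → PLE α) (s : β → α) : Finset (Fin N × β) :=
  Finset.univ.filter fun q => s q.2 ∈ (F q.1).toList

theorem cuts_subset_occurrences (F : Fin N → PLE α) (s : β → α) (a : α) :
    cuts F s a ⊆ occurrences F s := by
  intro q hq
  simp only [cuts, occurrences, Finset.mem_filter, Finset.mem_univ, true_and] at hq ⊢
  exact hq.1.mem_right

theorem card_occurrences (F : Fin N → PLE α) (s : β → α) :
    (occurrences F s).card = ∑ b, mult F (s b) := by
  simp only [occurrences, mult, Finset.card_filter]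
  rw [Fintype.sum_prod_type_right]

end Cuts

theorem card_powerset_filter_card_le {γ : Type*} (T : Finset γ) {n d : ℕ} (hn : 0 < n)
    (hT : T.card ≤ n * d) :
    ((T.powerset.filter fun S => S.card ≤ d).card : ℝ) ≤ (Real.exp 1 * n) ^ d := by
  have hn' : (1 : ℝ) ≤ n := by exact_mod_cast hn
  have hn0 : (0 : ℝ) < n := by linarith
  have h₁ : ((T.powerset.filter fun S => S.card ≤ d).card : ℝ) * ((n : ℝ)⁻¹) ^ d ≤
      (1 + (n : ℝ)⁻¹) ^ T.card := by
    rw [add_comm, ← Finset.sum_pow_mul_eq_add_pow, ← nsmul_eq_mul]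
    refine le_trans (Finset.card_nsmul_le_sum _ (fun S => ((n : ℝ)⁻¹) ^ S.card) _ ?_) ?_
    · intro S hS
      exact pow_le_pow_of_le_one (by positivity) (inv_le_one_of_one_le₀ hn')
        (Finset.mem_filter.1 hS).2
    · simp only [one_pow, mul_one]
      exact Finset.sum_le_sum_of_subset_of_nonneg (Finset.filter_subset _ _)
        fun _ _ _ => by positivity
  have h₂ : (1 + (n : ℝ)⁻¹) ^ T.card ≤ Real.exp 1 ^ d := by
    calc (1 + (n : ℝ)⁻¹) ^ T.card ≤ (1 + (n : ℝ)⁻¹) ^ (n * d) :=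
          pow_le_pow_right₀ (by simp) hT
      _ ≤ (Real.exp (n : ℝ)⁻¹) ^ (n * d) := by
          gcongr
          rw [add_comm]
          exact Real.add_one_le_exp _
      _ = Real.exp 1 ^ d := by
          rw [pow_mul, ← Real.exp_nat_mul, mul_inv_cancel₀ hn0.ne']
  have h₃ := h₁.trans h₂
  rw [inv_pow, ← div_eq_mul_inv, div_le_iff₀ (by positivity)] at h₃
  rwa [mul_pow]

theorem choose_le_exp_mul_pow_ldim {n k : ℕ} (hk : 2 ≤ k) (hn : 0 < n) :
    (n.choose k : ℝ) ≤ (Real.exp 1 * n) ^ ldim (BoolLayers n 1 k) := by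
  obtain ⟨N, F, hF, hm⟩ := exists_mult_le_ldim (BoolLayers n 1 k)
  let s : Fin n → BoolLayers n 1 k := fun x => ⟨{x}, Or.inl (by simp)⟩
  have hs : Function.Injective s := fun x y h => by simpa [s] using h
  have hT : (occurrences F s).card ≤ n * ldim (BoolLayers n 1 k) := by
    rw [card_occurrences]
    simpa using Finset.sum_le_card_nsmul Finset.univ _ _ fun b _ => hm (s b)
  refine le_trans ?_ (card_powerset_filter_card_le _ hn hT)
  have hcard : (Finset.powersetCard k (Finset.univ : Finset (Fin n))).card = n.choose k := by
    simp
  rw [← hcard]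
  have hmem : ∀ (A : Finset (Fin n)) (hA : A.card = k) (y : Fin n),
      y ∉ A ↔ ∃ q ∈ cuts F s ⟨A, Or.inr hA⟩, (F q.1).Before (s q.2) (s y) := by
    intro A hA y
    constructor
    · intro hy
      obtain ⟨i, hi⟩ := hF ⟨A, Or.inr hA⟩ (s y) (by simpa [s] using hy)
      obtain ⟨c, hc, hcy⟩ := exists_mem_cuts F s hi
      exact ⟨(i, c), hc, hcy⟩
    · rintro ⟨q, hq, hqy⟩ hy
      simp only [cuts, Finset.mem_filter, Finset.mem_univ, true_and] at hq
      have hA' := hq.1.trans hqy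
      have h : (⟨A, Or.inr hA⟩ : BoolLayers n 1 k) = s y := hA'.antisymm
        ((F q.1).before_of_le hA'.mem_right hA'.mem_left (by simpa [s] using hy))
      have hAy : A = {y} := Subtype.ext_iff.1 h
      have hA1 : A.card = 1 := hAy ▸ Finset.card_singleton y
      omega
  norm_cast
  refine Finset.card_le_card_of_injOn
    (fun A => if hA : A.card = k then cuts F s ⟨A, Or.inr hA⟩ else ∅) ?_ ?_
  · intro A hA
    have hA : A.card = k := by simpa using hA
    simp only [hA, dite_true, Finset.coe_filter, Set.mem_ofPred_eq, Finset.mem_powerset]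
    exact ⟨cuts_subset_occurrences _ _ _, (card_cuts_le F hs _).trans (hm _)⟩
  · intro A hA B hB h
    have hA : A.card = k := by simpa using hA
    have hB : B.card = k := by simpa using hB
    simp only [hA, hB, dite_true] at h
    ext y
    rw [← not_iff_not, hmem A hA, hmem B hB, h]

theorem two_pow_le_succ_mul_choose_half (n : ℕ) : 2 ^ n ≤ (n + 1) * n.choose (n / 2) := by
  rw [← Nat.sum_range_choose]
  simpa using Finset.sum_le_card_nsmul (Finset.range (n + 1)) _ _
    fun i _ => Nat.choose_le_middle i n

theorem two_pow_le_succ_mul_exp_mul_pow_ldim {n : ℕ} (hn : 4 ≤ n) :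
    (2 : ℝ) ^ n ≤ (n + 1) * (Real.exp 1 * n) ^ ldim (BoolLayers n 1 (n / 2)) :=
  calc (2 : ℝ) ^ n ≤ (n + 1) * n.choose (n / 2) := by
        exact_mod_cast two_pow_le_succ_mul_choose_half n
    _ ≤ _ := by
        gcongr
        exact choose_le_exp_mul_pow_ldim (by omega) (by omega)

theorem logb_two_le_self {x : ℝ} (hx : 0 < x) : Real.logb 2 x ≤ x := by
  rw [Real.logb, div_le_iff₀ (Real.log_pos one_lt_two)]
  have h := Real.log_le_sub_one_of_pos (half_pos hx)
  rw [Real.log_div hx.ne' two_ne_zero] at h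
  nlinarith [Real.log_two_gt_d9, Real.log_two_lt_d9, Real.log_le_sub_one_of_pos hx]

theorem logb_two_sq_le {x : ℝ} (hx : 1 ≤ x) : Real.logb 2 x ^ 2 ≤ 4 * x := by
  have h0 : 0 ≤ Real.logb 2 x := Real.logb_nonneg one_lt_two hx
  have h₁ := logb_two_le_self (Real.sqrt_pos.2 (zero_lt_one.trans_le hx))
  have h₂ : Real.logb 2 (Real.sqrt x) = Real.logb 2 x / 2 := by
    rw [Real.logb, Real.logb, Real.log_sqrt (by linarith)]
    ring
  rw [h₂] at h₁
  nlinarith [Real.sq_sqrt (zero_le_one.trans hx), Real.sqrt_nonneg x]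

theorem le_logb_add_mul_logb {n d : ℕ} (hn : 1 ≤ n)
    (h : (2 : ℝ) ^ n ≤ (n + 1) * (Real.exp 1 * n) ^ d) :
    (n : ℝ) ≤ Real.logb 2 n + 1 + d * (Real.logb 2 n + 2) := by
  have hn' : (1 : ℝ) ≤ n := by exact_mod_cast hn
  have hn0 : (0 : ℝ) < n := by linarith
  have he : Real.exp 1 ≤ 4 := Real.exp_one_lt_d9.le.trans (by norm_num)
  have h' : (2 : ℝ) ^ n ≤ (2 * n) * (4 * n) ^ d := by
    refine h.trans ?_
    gcongr
    linarith
  have h4 : Real.logb 2 4 = 2 := by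
    rw [show (4 : ℝ) = 2 ^ 2 by norm_num, Real.logb_pow, Real.logb_self_eq_one one_lt_two]
    norm_num
  have hlog := Real.logb_le_logb_of_le one_lt_two (by positivity) h'
  rw [Real.logb_pow, Real.logb_mul (by positivity) (by positivity), Real.logb_pow,
    Real.logb_mul two_ne_zero hn0.ne', Real.logb_mul four_ne_zero hn0.ne',
    Real.logb_self_eq_one one_lt_two, h4] at hlog
  linarith

end PaperLD

open PaperLD

/-- There is `C > 0` such that for every `n ≥ 4`,
`ldim(Q(n)) ≥ ldim(Q(n; 1, ⌊n/2⌋)) ≥ n/log n − C·n·log log n/(log n)²` (logs base 2). -/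
theorem stmt8 :
    ∃ C : ℝ, 0 < C ∧ ∀ n : ℕ, 4 ≤ n →
      ldim (BoolLayers n 1 (n / 2)) ≤ ldim (Finset (Fin n)) ∧
      (n : ℝ) / Real.logb 2 n -
          C * n * Real.logb 2 (Real.logb 2 n) / (Real.logb 2 n) ^ 2 ≤
        (ldim (BoolLayers n 1 (n / 2)) : ℝ) := by
  refine ⟨6, by norm_num, fun n hn => ⟨ldim_subtype_le _, ?_⟩⟩
  have hn' : (4 : ℝ) ≤ n := by exact_mod_cast hn
  have hL : 2 ≤ Real.logb 2 n := by
    rw [Real.le_logb_iff_rpow_le one_lt_two (by linarith)]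
    norm_num
    exact_mod_cast hn
  have hll : 1 ≤ Real.logb 2 (Real.logb 2 n) := by
    rw [Real.le_logb_iff_rpow_le one_lt_two (by linarith)]
    simpa using hL
  have hsq := logb_two_sq_le (x := n) (by linarith)
  have hmain := le_logb_add_mul_logb (by omega) (two_pow_le_succ_mul_exp_mul_pow_ldim hn)
  generalize (ldim (BoolLayers n 1 (n / 2)) : ℝ) = d at hmain ⊢
  generalize Real.logb 2 (Real.logb 2 n) = l at hll ⊢
  generalize Real.logb 2 n = L at *
  generalize (n : ℝ) = x at *
  have hd : x / (L + 2) - 1 ≤ d := by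
    rw [sub_le_iff_le_add, div_le_iff₀ (by linarith)]
    linarith
  have hdiff : x / L - x / (L + 2) ≤ 2 * x / L ^ 2 := by
    rw [div_sub_div _ _ (by positivity) (by positivity),
      div_le_div_iff₀ (by positivity) (by positivity)]
    nlinarith [mul_pos (show 0 < x by linarith) (show 0 < L by linarith)]
  have hone : 1 ≤ 4 * x / L ^ 2 := by
    rwa [one_le_div (by positivity)]
  have hC : 2 * x / L ^ 2 + 4 * x / L ^ 2 ≤ 6 * x * l / L ^ 2 := by
    rw [← add_div]
    gcongr
    nlinarith
  linarith
end
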